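/- Let 1 < p < ∞, 1 ≤ q, r ≤ ∞, let p' be the conjugate exponent of p, and let −N/p < a < N/p'. Then the Hardy–Littlewood maximal operator M, defined for locally integrable f on ℝ^N by Mf(x) = sup_{ρ>0} (1/μ(B(x,ρ))) ∫_{B(x,ρ)} |f(y)| dμ(y), is bounded on HL^{a,r}_{p,q}(ℝ^N): there exists a constant C such that ‖Mf‖_{HL^{a,r}_{p,q}} ≤ C ‖f‖_{HL^{a,r}_{p,q}} for all f ∈ HL^{a,r}_{p,q}(ℝ^N). -/

import Mathlib

open MeasureTheory ENNReal Set Filter Topology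

noncomputable section

variable {X : Type*}

/-- The decreasing rearrangement `f*` of `f` with respect to `μ` :
`f*(s) = inf {α ≥ 0 : μ({x : |f(x)| > α}) ≤ s}`. -/
def rearr [MeasurableSpace X] (μ : Measure X) (f : X → ℝ) (s : ℝ) : ℝ≥0∞ :=
  sInf {α : ℝ≥0∞ | μ {x | α < ENNReal.ofReal |f x|} ≤ ENNReal.ofReal s}

/-- The averaged (maximal) rearrangement `f**(s) = (1/s)∫_0^s f*(t) dt`. -/
def rearrStar [MeasurableSpace X] (μ : Measure X) (f : X → ℝ) (s : ℝ) : ℝ≥0∞ :=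
  (ENNReal.ofReal s)⁻¹ * ∫⁻ t in Set.Ioc (0 : ℝ) s, rearr μ f t

/-- The Lorentz functional built from a rearrangement-type function `R`:
`(∫_0^∞ (t^{1/p} R(t))^r dt/t)^{1/r}` for `r < ∞`, and `sup_{t>0} t^{1/p} R(t)`
for `r = ∞` (when `p = ∞`, `1/p` is interpreted as `0`, which for `R = f*`
recovers the essential supremum of `|f|`). -/
def lorentzNormOf (R : ℝ → ℝ≥0∞) (p r : ℝ≥0∞) : ℝ≥0∞ :=
  if r = ∞ then ⨆ t : {t : ℝ // 0 < t}, ENNReal.ofReal (t.1 ^ p.toReal⁻¹) * R t.1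
  else (∫⁻ t in Set.Ioi (0 : ℝ),
      (ENNReal.ofReal (t ^ p.toReal⁻¹) * R t) ^ r.toReal / ENNReal.ofReal t) ^ r.toReal⁻¹

/-- The Lorentz quasi-norm `‖f‖_{L^{p,r}}`. -/
def lorentzNorm [MeasurableSpace X] (μ : Measure X) (p r : ℝ≥0∞) (f : X → ℝ) : ℝ≥0∞ :=
  lorentzNormOf (rearr μ f) p r

/-- The Lorentz norm `‖f‖*_{L^{p,r}}`, with `f*` replaced by `f**`. -/
def lorentzNormStar [MeasurableSpace X] (μ : Measure X) (p r : ℝ≥0∞) (f : X → ℝ) : ℝ≥0∞ :=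
  lorentzNormOf (rearrStar μ f) p r

/-- The annuli `A_u`, `u ≥ -1`:  `A_{-1} = {x ∈ Ω : |x| < 1/2}` and, for `u ≥ 0`,
`A_u = {x ∈ Ω : 2^{u-1} ≤ |x| < 2^u}`. -/
def annulus [Norm X] (Ω : Set X) (u : ℤ) : Set X :=
  if u = -1 then {x ∈ Ω | ‖x‖ < 1 / 2}
  else {x ∈ Ω | (2 : ℝ) ^ (u - 1) ≤ ‖x‖ ∧ ‖x‖ < (2 : ℝ) ^ u}

/-- The Herz-type functional built from a functional `L` on the blocks:
`(Σ_{u ≥ -1} (2^{ua} L(f χ_{A_u}))^q)^{1/q}` for `q < ∞`, with the sup-modification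
for `q = ∞`. -/
def herzNormWith {E : Type*} [Norm X] [Zero E] (Ω : Set X) (a : ℝ) (q : ℝ≥0∞)
    (L : (X → E) → ℝ≥0∞) (f : X → E) : ℝ≥0∞ :=
  if q = ∞ then
    ⨆ u : {u : ℤ // -1 ≤ u},
      ENNReal.ofReal ((2 : ℝ) ^ ((u.1 : ℝ) * a)) * L ((annulus Ω u.1).indicator f)
  else (∑' u : {u : ℤ // -1 ≤ u},
      (ENNReal.ofReal ((2 : ℝ) ^ ((u.1 : ℝ) * a)) * L ((annulus Ω u.1).indicator f)) ^ q.toReal)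
      ^ q.toReal⁻¹

/-- The non-homogeneous Lorentz–Herz quasi-norm `‖f‖_{HL^{a,r}_{p,q}}`. -/
def herzNorm [MeasurableSpace X] [Norm X] (μ : Measure X) (Ω : Set X) (a : ℝ)
    (p q r : ℝ≥0∞) (f : X → ℝ) : ℝ≥0∞ :=
  herzNormWith Ω a q (lorentzNorm μ p r) f

/-- The non-homogeneous Lorentz–Herz norm `‖f‖*_{HL^{a,r}_{p,q}}`, built from the
Lorentz norms `‖·‖*_{L^{p,r}}`. -/
def herzNormStar [MeasurableSpace X] [Norm X] (μ : Measure X) (Ω : Set X) (a : ℝ)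
    (p q r : ℝ≥0∞) (f : X → ℝ) : ℝ≥0∞ :=
  herzNormWith Ω a q (lorentzNormStar μ p r) f

/-- The conjugate exponent: `1/p + 1/p' = 1`, with `1' = ∞` and `∞' = 1`. -/
def conjExp (p : ℝ≥0∞) : ℝ≥0∞ :=
  if p = 1 then ∞ else if p = ∞ then 1 else ENNReal.ofReal (p.toReal / (p.toReal - 1))

/-- The quantity `(Σ_{u≥-1} (2^{ua} μ(A_u ∩ E)^{1/p})^q)^{(of the summands)}`,
i.e. `Σ_{u≥-1} 2^{uaq} μ(A_u ∩ E)^{q/p}` for `q < ∞`, with the sup-modification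
for `q = ∞`. -/
def herzSetNorm [MeasurableSpace X] [Norm X] (μ : Measure X) (Ω : Set X) (a : ℝ)
    (p q : ℝ≥0∞) (E : Set X) : ℝ≥0∞ :=
  if q = ∞ then
    ⨆ u : {u : ℤ // -1 ≤ u},
      ENNReal.ofReal ((2 : ℝ) ^ ((u.1 : ℝ) * a)) * μ (annulus Ω u.1 ∩ E) ^ p.toReal⁻¹
  else ∑' u : {u : ℤ // -1 ≤ u},
      (ENNReal.ofReal ((2 : ℝ) ^ ((u.1 : ℝ) * a)) * μ (annulus Ω u.1 ∩ E) ^ p.toReal⁻¹) ^ q.toReal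

/-- The Peetre K-functional for the couple of quasi-normed function spaces
determined by the functionals `n₀`, `n₁`. -/
def Kfun [MeasurableSpace X] (n₀ n₁ : (X → ℝ) → ℝ≥0∞) (t : ℝ) (f : X → ℝ) : ℝ≥0∞ :=
  ⨅ (g : X → ℝ) (_ : Measurable g) (_ : Measurable (f - g)),
    n₀ g + ENNReal.ofReal t * n₁ (f - g)

/-- The real interpolation quasi-norm `‖f‖_{(X₀,X₁)_{θ,q}}`. -/
def interpNorm [MeasurableSpace X] (n₀ n₁ : (X → ℝ) → ℝ≥0∞) (θ : ℝ) (q : ℝ≥0∞)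
    (f : X → ℝ) : ℝ≥0∞ :=
  if q = ∞ then ⨆ t : {t : ℝ // 0 < t}, ENNReal.ofReal (t.1 ^ (-θ)) * Kfun n₀ n₁ t.1 f
  else (∫⁻ t in Set.Ioi (0 : ℝ),
      (ENNReal.ofReal (t ^ (-θ)) * Kfun n₀ n₁ t f) ^ q.toReal / ENNReal.ofReal t) ^ q.toReal⁻¹

/-- Membership in the sum `X₀ + X₁` of the couple determined by `n₀`, `n₁`. -/
def inSum [MeasurableSpace X] (n₀ n₁ : (X → ℝ) → ℝ≥0∞) (f : X → ℝ) : Prop :=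
  ∃ g : X → ℝ, Measurable g ∧ Measurable (f - g) ∧ n₀ g < ∞ ∧ n₁ (f - g) < ∞

end
abbrev Euc (N : ℕ) : Type := EuclideanSpace ℝ (Fin N)

noncomputable section

/-- The decreasing rearrangement of an `ℝ≥0∞`-valued function. -/
def rearrE {X : Type*} [MeasurableSpace X] (μ : Measure X) (g : X → ℝ≥0∞) (s : ℝ) : ℝ≥0∞ :=
  sInf {α : ℝ≥0∞ | μ {x | α < g x} ≤ ENNReal.ofReal s}

/-- The Lorentz quasi-norm of an `ℝ≥0∞`-valued function. -/
def lorentzNormE {X : Type*} [MeasurableSpace X] (μ : Measure X) (p r : ℝ≥0∞)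
    (g : X → ℝ≥0∞) : ℝ≥0∞ :=
  lorentzNormOf (rearrE μ g) p r

/-- The non-homogeneous Lorentz–Herz quasi-norm of an `ℝ≥0∞`-valued function. -/
def herzNormE {X : Type*} [MeasurableSpace X] [Norm X] (μ : Measure X) (Ω : Set X)
    (a : ℝ) (p q r : ℝ≥0∞) (g : X → ℝ≥0∞) : ℝ≥0∞ :=
  herzNormWith Ω a q (lorentzNormE μ p r) g

/-- The Hardy–Littlewood maximal operator
`Mf(x) = sup_{ρ>0} (1/μ(B(x,ρ))) ∫_{B(x,ρ)} |f(y)| dμ(y)`. -/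
def hlMaximal {X : Type*} [MeasurableSpace X] [PseudoMetricSpace X] (μ : Measure X)
    (f : X → ℝ) (x : X) : ℝ≥0∞ :=
  ⨆ ρ : {ρ : ℝ // 0 < ρ},
    (μ (Metric.ball x ρ.1))⁻¹ * ∫⁻ y in Metric.ball x ρ.1, ENNReal.ofReal |f y| ∂μ

end

namespace LorentzHerz

/-- Countable Minkowski inequality. -/
lemma lp_sum {T ι : Type*} [MeasurableSpace T] (ν : Measure T)
    (F : ι → T → ℝ≥0∞) (hF : ∀ i, Measurable (F i)) {r : ℝ} (hr : 1 ≤ r) (s : Finset ι) :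
    (∫⁻ t, (∑ i ∈ s, F i t) ^ r ∂ν) ^ r⁻¹ ≤ ∑ i ∈ s, (∫⁻ t, (F i t) ^ r ∂ν) ^ r⁻¹ := by
  classical
  induction s using Finset.induction_on with
  | empty =>
    have : 0 < r := by linarith
    simp [this]
  | insert i s hi ih =>
    rw [Finset.sum_insert hi]
    have h := ENNReal.lintegral_Lp_add_le (μ := ν) (f := F i) (g := fun t => ∑ j ∈ s, F j t)
      (hF i).aemeasurable (Finset.measurable_sum s (fun j _ => hF j)).aemeasurable hr
    simp only [Pi.add_apply, one_div] at h
    calc _ = (∫⁻ t, (F i t + ∑ j ∈ s, F j t) ^ r ∂ν) ^ r⁻¹ := by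
          simp only [Finset.sum_insert hi]
      _ ≤ _ := h.trans (by gcongr)

lemma lp_tsum {T ι : Type*} [MeasurableSpace T] [Countable ι] (ν : Measure T)
    (F : ι → T → ℝ≥0∞) (hF : ∀ i, Measurable (F i)) {r : ℝ} (hr : 1 ≤ r) :
    (∫⁻ t, (∑' i, F i t) ^ r ∂ν) ^ r⁻¹ ≤ ∑' i, (∫⁻ t, (F i t) ^ r ∂ν) ^ r⁻¹ := by
  classical
  have hr0 : 0 < r := by linarith
  have h1 : ∀ t, (∑' i, F i t) ^ r = ⨆ s : Finset ι, (∑ i ∈ s, F i t) ^ r := by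
    intro t
    rw [ENNReal.tsum_eq_iSup_sum]
    exact (ENNReal.orderIsoRpow r hr0).map_iSup _
  simp only [h1]
  rw [lintegral_iSup_directed]
  · rw [show (⨆ s : Finset ι, ∫⁻ t, (∑ i ∈ s, F i t) ^ r ∂ν) ^ r⁻¹
        = ⨆ s : Finset ι, (∫⁻ t, (∑ i ∈ s, F i t) ^ r ∂ν) ^ r⁻¹ from
        (ENNReal.orderIsoRpow r⁻¹ (inv_pos.2 hr0)).map_iSup _]
    refine iSup_le fun s => (lp_sum ν F hF hr s).trans (ENNReal.sum_le_tsum s)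
  · intro s
    exact ((Finset.measurable_sum s (fun j _ => hF j)).pow_const r).aemeasurable
  · refine Monotone.directed_le fun s s' h t => ?_
    gcongr

lemma lint_dil {c : ℝ} (hc : 0 < c) (g : ℝ → ℝ≥0∞) :
    ∫⁻ t in Ioi (0:ℝ), g (c * t) = ENNReal.ofReal c⁻¹ * ∫⁻ t in Ioi (0:ℝ), g t := by
  have hemb : MeasurableEmbedding (fun x : ℝ => c * x) :=
    (Homeomorph.mulLeft₀ c hc.ne').measurableEmbedding
  rw [← lintegral_indicator measurableSet_Ioi, ← lintegral_indicator measurableSet_Ioi]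
  have h1 : ∀ t, (Ioi (0:ℝ)).indicator (fun t => g (c * t)) t
      = (Ioi (0:ℝ)).indicator g (c * t) := by
    intro t
    by_cases ht : 0 < t
    · have : 0 < c * t := by positivity
      simp [indicator, ht, this]
    · have : ¬ 0 < c * t := fun h => ht (pos_of_mul_pos_right h hc.le)
      simp [indicator, ht, this]
  simp only [h1]
  rw [← hemb.lintegral_map, Real.map_volume_mul_left hc.ne', lintegral_smul_measure,
    abs_of_pos (inv_pos.2 hc)]
  rfl

lemma lz_mono {R R' : ℝ → ℝ≥0∞} (p r : ℝ≥0∞) (h : ∀ t, 0 < t → R t ≤ R' t) :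
    lorentzNormOf R p r ≤ lorentzNormOf R' p r := by
  unfold lorentzNormOf
  split_ifs with hr
  · exact iSup_mono fun t => by gcongr; exact h _ t.2
  · refine ENNReal.rpow_le_rpow ?_ (by positivity)
    refine setLIntegral_mono' measurableSet_Ioi fun t ht => ?_
    gcongr
    exact h t ht

lemma lz_eq {R : ℝ → ℝ≥0∞} {p r : ℝ≥0∞} (hr : 1 ≤ r) (hr' : r ≠ ∞) :
    lorentzNormOf R p r = (∫⁻ t in Ioi (0:ℝ),
      (ENNReal.ofReal (t ^ (p.toReal⁻¹ - r.toReal⁻¹)) * R t) ^ r.toReal) ^ r.toReal⁻¹ := by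
  have hr0 : 0 < r.toReal := ENNReal.toReal_pos (by intro h; simp [h] at hr) hr'
  unfold lorentzNormOf
  rw [if_neg hr']
  congr 1
  refine setLIntegral_congr_fun measurableSet_Ioi fun t ht => ?_
  have ht : 0 < t := ht
  rw [ENNReal.mul_rpow_of_nonneg _ _ hr0.le, ENNReal.mul_rpow_of_nonneg _ _ hr0.le,
    Real.rpow_sub ht, ENNReal.ofReal_div_of_pos (by positivity),
    ENNReal.div_rpow_of_nonneg _ _ hr0.le,
    ENNReal.ofReal_rpow_of_pos (x := t ^ r.toReal⁻¹) (by positivity), ← Real.rpow_mul ht.le,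
    inv_mul_cancel₀ hr0.ne', Real.rpow_one, div_eq_mul_inv, div_eq_mul_inv]
  ring

lemma lz_tsum {ι : Type*} [Countable ι] {F : ι → ℝ → ℝ≥0∞} (hF : ∀ i, Measurable (F i))
    (p : ℝ≥0∞) {r : ℝ≥0∞} (hr : 1 ≤ r) :
    lorentzNormOf (fun t => ∑' i, F i t) p r ≤ ∑' i, lorentzNormOf (F i) p r := by
  by_cases hr' : r = ∞
  · unfold lorentzNormOf
    simp only [if_pos hr']
    refine iSup_le fun t => ?_
    rw [← ENNReal.tsum_mul_left]
    refine ENNReal.tsum_le_tsum fun i => ?_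
    exact le_iSup (fun t : {t : ℝ // 0 < t} => ENNReal.ofReal (t.1 ^ p.toReal⁻¹) * F i t.1) t
  · simp only [lz_eq hr hr', ← ENNReal.tsum_mul_left]
    refine lp_tsum _ (fun i t => ENNReal.ofReal (t ^ (p.toReal⁻¹ - r.toReal⁻¹)) * F i t) ?_ ?_
    · intro i
      have := hF i
      fun_prop
    · exact (ENNReal.toReal_mono hr' hr).trans' (by simp)

lemma lz_const {R : ℝ → ℝ≥0∞} (hR : Measurable R) (c p : ℝ≥0∞) {r : ℝ≥0∞} (hr : 1 ≤ r) :
    lorentzNormOf (fun t => c * R t) p r = c * lorentzNormOf R p r := by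
  by_cases hr' : r = ∞
  · unfold lorentzNormOf
    simp only [if_pos hr']
    rw [ENNReal.mul_iSup]
    congr! 2
    ring
  · have hr0 : 0 < r.toReal := ENNReal.toReal_pos (by intro h; simp [h] at hr) hr'
    simp only [lz_eq hr hr']
    simp only [mul_left_comm _ c, ENNReal.mul_rpow_of_nonneg c _ hr0.le]
    rw [lintegral_const_mul _ (by fun_prop), ENNReal.mul_rpow_of_nonneg _ _ (by positivity),
      ← ENNReal.rpow_mul, mul_inv_cancel₀ hr0.ne', ENNReal.rpow_one]

lemma lz_dil (R : ℝ → ℝ≥0∞) {c : ℝ} (hc : 0 < c) (p : ℝ≥0∞) {r : ℝ≥0∞} (hr : 1 ≤ r) :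
    lorentzNormOf (fun t => R (c * t)) p r
      ≤ ENNReal.ofReal (c ^ (-p.toReal⁻¹)) * lorentzNormOf R p r := by
  by_cases hr' : r = ∞
  · unfold lorentzNormOf
    simp only [if_pos hr']
    rw [ENNReal.mul_iSup]
    refine iSup_le fun t => ?_
    refine le_iSup_of_le (⟨c * t.1, mul_pos hc t.2⟩ : {t : ℝ // 0 < t}) (le_of_eq ?_)
    dsimp only
    rw [← mul_assoc, ← ENNReal.ofReal_mul (by positivity), Real.mul_rpow hc.le t.2.le, ← mul_assoc,
      ← Real.rpow_add hc]
    simp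
  · have hr0 : 0 < r.toReal := ENNReal.toReal_pos (by intro h; simp [h] at hr) hr'
    simp only [lz_eq hr hr']
    have h1 : ∫⁻ t in Ioi (0:ℝ),
        (ENNReal.ofReal (t ^ (p.toReal⁻¹ - r.toReal⁻¹)) * R (c * t)) ^ r.toReal
        = ∫⁻ t in Ioi (0:ℝ), (fun s => ENNReal.ofReal (c ^ (-(p.toReal⁻¹ - r.toReal⁻¹))) ^ r.toReal *
          (ENNReal.ofReal (s ^ (p.toReal⁻¹ - r.toReal⁻¹)) * R s) ^ r.toReal) (c * t) := by
      refine setLIntegral_congr_fun measurableSet_Ioi fun t ht => ?_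
      have ht : 0 < t := ht
      dsimp only
      rw [← ENNReal.mul_rpow_of_nonneg _ _ hr0.le, ← mul_assoc,
        ← ENNReal.ofReal_mul (by positivity), Real.mul_rpow hc.le ht.le, ← mul_assoc,
        ← Real.rpow_add hc]
      simp
    rw [h1.trans (lint_dil hc (fun s => ENNReal.ofReal (c ^ (-(p.toReal⁻¹ - r.toReal⁻¹))) ^ r.toReal *
          (ENNReal.ofReal (s ^ (p.toReal⁻¹ - r.toReal⁻¹)) * R s) ^ r.toReal)), lintegral_const_mul' _ _ (by finiteness),
      ENNReal.mul_rpow_of_nonneg _ _ (by positivity),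
      ENNReal.mul_rpow_of_nonneg _ _ (by positivity), ← ENNReal.rpow_mul, mul_inv_cancel₀ hr0.ne',
      ENNReal.rpow_one, ← mul_assoc, ENNReal.ofReal_rpow_of_pos (by positivity),
      ← ENNReal.ofReal_mul (by positivity)]
    apply le_of_eq
    congr 2
    rw [← Real.rpow_neg_one c, ← Real.rpow_mul hc.le, ← Real.rpow_add hc]
    congr 1
    ring

lemma lz_weak (p : ℝ≥0∞) {r : ℝ≥0∞} (hr : 1 ≤ r) {φ : ℝ → ℝ≥0∞} (hφ : Antitone φ)
    {t : ℝ} (ht : 0 < t) :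
    ENNReal.ofReal (t ^ p.toReal⁻¹) * φ t
      ≤ (ENNReal.ofReal (2 ^ p.toReal⁻¹) * 2) * lorentzNormOf φ p r := by
  have hθ : 0 ≤ p.toReal⁻¹ := by positivity
  by_cases hr' : r = ∞
  · have h2 : (1:ℝ≥0∞) ≤ ENNReal.ofReal (2 ^ p.toReal⁻¹) * 2 := by
      refine one_le_mul ?_ (by norm_num)
      rw [ENNReal.one_le_ofReal]
      exact Real.one_le_rpow (by norm_num) hθ
    refine le_trans ?_ (le_mul_of_one_le_left' h2)
    unfold lorentzNormOf
    rw [if_pos hr']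
    exact le_iSup (fun t : {t : ℝ // 0 < t} => ENNReal.ofReal (t.1 ^ p.toReal⁻¹) * φ t.1) ⟨t, ht⟩
  · have hr0 : 0 < r.toReal := ENNReal.toReal_pos (by intro h; simp [h] at hr) hr'
    have hr1 : 1 ≤ r.toReal := (ENNReal.toReal_mono hr' hr).trans' (by simp)
    set X := ENNReal.ofReal ((t / 2) ^ p.toReal⁻¹) * φ t with hX
    have h1 : X ^ r.toReal * 2⁻¹ ≤ ∫⁻ t in Set.Ioi (0 : ℝ),
      (ENNReal.ofReal (t ^ p.toReal⁻¹) * φ t) ^ r.toReal / ENNReal.ofReal t := by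
      calc X ^ r.toReal * 2⁻¹ = ∫⁻ s in Ioc (t / 2) t, X ^ r.toReal / ENNReal.ofReal t := by
            rw [setLIntegral_const, Real.volume_Ioc, div_eq_mul_inv, mul_assoc]
            congr 1
            rw [show t - t / 2 = t * 2⁻¹ by ring, ENNReal.ofReal_mul ht.le, ← mul_assoc,
              ENNReal.inv_mul_cancel (by simpa using ht) (by simp), one_mul,
              ENNReal.ofReal_inv_of_pos (by norm_num)]
            simp
        _ ≤ ∫⁻ s in Ioc (t / 2) t,
              (ENNReal.ofReal (s ^ p.toReal⁻¹) * φ s) ^ r.toReal / ENNReal.ofReal s := by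
            refine setLIntegral_mono' measurableSet_Ioc fun s hs => ?_
            have : 0 < s := lt_trans (by positivity) hs.1
            rw [hX]
            gcongr
            · exact hs.1.le
            · exact hφ hs.2
            · exact hs.2
        _ ≤ _ := lintegral_mono_set fun s hs => lt_trans (by positivity : 0 < t / 2) hs.1
    have h2 : X * 2⁻¹ ≤ lorentzNormOf φ p r := by
      unfold lorentzNormOf
      rw [if_neg hr']
      refine le_trans ?_ (ENNReal.rpow_le_rpow h1 (by positivity))
      rw [ENNReal.mul_rpow_of_nonneg _ _ (by positivity), ← ENNReal.rpow_mul,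
        mul_inv_cancel₀ hr0.ne', ENNReal.rpow_one]
      gcongr
      calc (2⁻¹ : ℝ≥0∞) = 2⁻¹ ^ (1:ℝ) := by simp
        _ ≤ _ := ENNReal.rpow_le_rpow_of_exponent_ge (by simp) (inv_le_one_of_one_le₀ hr1)
    calc ENNReal.ofReal (t ^ p.toReal⁻¹) * φ t
        = ENNReal.ofReal (2 ^ p.toReal⁻¹) * 2 * (X * 2⁻¹) := by
          rw [show t ^ p.toReal⁻¹ = 2 ^ p.toReal⁻¹ * (t / 2) ^ p.toReal⁻¹ by
            rw [← Real.mul_rpow (by norm_num) (by positivity)]; congr 1; ring,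
            ENNReal.ofReal_mul (by positivity), hX]
          rw [mul_assoc, mul_assoc, mul_comm (2:ℝ≥0∞), mul_assoc (_ * φ t) (2⁻¹) 2,
            ENNReal.inv_mul_cancel (by norm_num) (by norm_num), mul_one]
      _ ≤ _ := by gcongr

/-- Indicator of `(-∞, T)`. -/
noncomputable def stepF (T t : ℝ) : ℝ≥0∞ := if t < T then 1 else 0

lemma stepF_meas (T : ℝ) : Measurable (stepF T) := by
  unfold stepF
  exact Measurable.ite measurableSet_Iio measurable_const measurable_const

lemma lz_step_one {p r : ℝ≥0∞} (hp1 : 1 < p) (hp : p ≠ ∞) (hr : 1 ≤ r) :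
    lorentzNormOf (stepF 1) p r < ∞ := by
  have hp0 : 0 < p.toReal := ENNReal.toReal_pos (by intro h; simp [h] at hp1) hp
  have hθ : 0 < p.toReal⁻¹ := by positivity
  unfold lorentzNormOf stepF
  split_ifs with hr'
  · refine lt_of_le_of_lt (iSup_le fun t => ?_) ENNReal.one_lt_top
    split_ifs with h
    · rw [mul_one, ENNReal.ofReal_le_one]
      exact Real.rpow_le_one t.2.le h.le hθ.le
    · simp
  · have hr0 : 0 < r.toReal := ENNReal.toReal_pos (by intro h; simp [h] at hr) hr'
    refine ENNReal.rpow_lt_top_of_nonneg (by positivity) (ne_of_lt ?_)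
    have hIntg := (intervalIntegral.integrableOn_Ioo_rpow_iff (s := p.toReal⁻¹ * r.toReal - 1)
      (t := 1) one_pos).2 (by have := mul_pos hθ hr0; linarith)
    refine lt_of_le_of_lt ?_ hIntg.lintegral_lt_top
    rw [← lintegral_indicator measurableSet_Ioi, ← lintegral_indicator measurableSet_Ioo]
    refine lintegral_mono fun t => ?_
    by_cases h0 : 0 < t
    · by_cases h1 : t < 1
      · simp only [indicator, mem_Ioi, h0, h1, mem_Ioo, if_true, and_self, mul_one]
        rw [ENNReal.ofReal_rpow_of_nonneg (by positivity) hr0.le,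
          ← ENNReal.ofReal_div_of_pos h0, Real.rpow_sub h0, Real.rpow_mul h0.le, Real.rpow_one]
      · simp [indicator, h0, h1, hr0]
    · simp [indicator, h0]

lemma lz_step (p : ℝ≥0∞) {r : ℝ≥0∞} (hr : 1 ≤ r) {T : ℝ} (hT : 0 < T) :
    lorentzNormOf (stepF T) p r
      ≤ ENNReal.ofReal (T ^ p.toReal⁻¹) * lorentzNormOf (stepF 1) p r := by
  have h : stepF T = fun t => stepF 1 (T⁻¹ * t) := by
    funext t
    unfold stepF
    congr 1
    rw [inv_mul_lt_iff₀ hT, mul_one]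
  rw [h]
  refine (lz_dil _ (inv_pos.2 hT) p hr).trans (le_of_eq ?_)
  rw [Real.inv_rpow hT.le, Real.rpow_neg hT.le, inv_inv]

section rearrangement

variable {X : Type*} [MeasurableSpace X] (μ : Measure X)

lemma rearrE_anti (g : X → ℝ≥0∞) : Antitone (rearrE μ g) := by
  intro s t h
  unfold rearrE
  exact sInf_le_sInf fun α hα => le_trans hα (ENNReal.ofReal_le_ofReal h)

lemma rearrE_meas (g : X → ℝ≥0∞) (s : ℝ) :
    μ {x | rearrE μ g s < g x} ≤ ENNReal.ofReal s := by
  set S := {α : ℝ≥0∞ | μ {x | α < g x} ≤ ENNReal.ofReal s} with hS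
  have hne : S.Nonempty := ⟨∞, by simp [hS]⟩
  obtain ⟨u, hu, hul, huS⟩ := (isGLB_sInf S).exists_seq_antitone_tendsto hne
  have hr : rearrE μ g s = sInf S := rfl
  have : {x | rearrE μ g s < g x} ⊆ ⋃ n, {x | u n < g x} := by
    intro x hx
    change sInf S < g x at hx
    obtain ⟨n, hn⟩ := (huS.1.eventually_lt_const hx).exists
    exact mem_iUnion.2 ⟨n, hn⟩
  refine (measure_mono this).trans ?_
  rw [Monotone.measure_iUnion]
  · exact iSup_le fun n => huS.2 n
  · intro m n hmn x hx
    exact lt_of_le_of_lt (hu hmn) hx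

lemma rearrE_le {g : X → ℝ≥0∞} {s : ℝ} {α : ℝ≥0∞} (h : μ {x | α < g x} ≤ ENNReal.ofReal s) :
    rearrE μ g s ≤ α := sInf_le h

/-- Dyadic majorant of the averaged rearrangement. -/
noncomputable def avgS (φ : ℝ → ℝ≥0∞) (t : ℝ) : ℝ≥0∞ := ∑' k : ℕ, ENNReal.ofReal (2⁻¹ ^ k) * φ (2⁻¹ ^ (k+1) * t)

lemma avgS_meas {φ : ℝ → ℝ≥0∞} (hφ : Measurable φ) : Measurable (avgS φ) := by
  unfold avgS
  fun_prop

lemma le_avgS {φ : ℝ → ℝ≥0∞} (hφ : Antitone φ) {t : ℝ} (ht : 0 < t) : φ t ≤ avgS φ t := by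
  unfold avgS
  refine le_trans ?_ (ENNReal.le_tsum 0)
  simp only [pow_zero, ENNReal.ofReal_one, one_mul, zero_add, pow_one]
  apply hφ
  linarith

lemma int_le_avgS {g : X → ℝ≥0∞} (hg : Measurable g) {t : ℝ} (ht : 0 < t) :
    ∫⁻ x in {x | rearrE μ g t < g x}, g x ∂μ ≤ ENNReal.ofReal t * avgS (rearrE μ g) t := by
  set E : ℕ → Set X := fun k => {x | rearrE μ g (2⁻¹ ^ k * t) < g x} with hE
  have hEm : ∀ k, MeasurableSet (E k) := fun k => measurableSet_lt measurable_const hg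
  have hEμ : ∀ k, μ (E k) ≤ ENNReal.ofReal (2⁻¹ ^ k * t) := fun k => rearrE_meas μ g _
  have hE0 : E 0 = {x | rearrE μ g t < g x} := by simp [hE]
  have hnull : ∀ᵐ x ∂μ, ∃ k, x ∉ E k := by
    rw [ae_iff]
    simp only [not_exists, not_not]
    have hlim : Tendsto (fun k : ℕ => ENNReal.ofReal (2⁻¹ ^ k * t)) atTop (𝓝 0) := by
      rw [← ENNReal.ofReal_zero]
      apply ENNReal.tendsto_ofReal
      rw [← zero_mul t]
      exact (_root_.tendsto_pow_atTop_nhds_zero_of_lt_one (by norm_num) (by norm_num)).mul_const t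
    refine le_antisymm (ge_of_tendsto' hlim fun k => ?_) (zero_le)
    exact (measure_mono fun x (hx : ∀ k, x ∈ E k) => hx k).trans (hEμ k)
  rw [← hE0, ← lintegral_indicator (hEm 0)]
  calc ∫⁻ x, (E 0).indicator g x ∂μ
      ≤ ∫⁻ x, ∑' k : ℕ, (E k).indicator (fun _ => rearrE μ g (2⁻¹ ^ (k+1) * t)) x ∂μ := by
        refine lintegral_mono_ae ?_
        filter_upwards [hnull] with x hx
        classical
        by_cases h0 : x ∈ E 0
        · have hk := Nat.find_spec hx
          obtain ⟨j, hj⟩ : ∃ j, Nat.find hx = j + 1 := by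
            refine Nat.exists_eq_succ_of_ne_zero fun h => ?_
            rw [h] at hk
            exact hk h0
          have hjm : x ∈ E j := by
            by_contra h
            have := Nat.find_min' hx h
            omega
          rw [hj] at hk
          refine le_trans ?_ (ENNReal.le_tsum j)
          rw [indicator_of_mem h0, indicator_of_mem hjm]
          simpa [hE] using hk
        · rw [indicator_of_notMem h0]
          exact zero_le
    _ = ∑' k : ℕ, rearrE μ g (2⁻¹ ^ (k+1) * t) * μ (E k) := by
        rw [lintegral_tsum]
        · congr 1; funext k
          rw [lintegral_indicator_const (hEm k)]
        · exact fun k => (measurable_const.indicator (hEm k)).aemeasurable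
    _ ≤ _ := by
        unfold avgS
        rw [← ENNReal.tsum_mul_left]
        refine ENNReal.tsum_le_tsum fun k => ?_
        refine (mul_le_mul_right (hEμ k) _).trans (le_of_eq ?_)
        rw [ENNReal.ofReal_mul (by positivity)]
        ring

end rearrangement

/-- Constant of the Hardy inequality. -/
noncomputable def hardyC (p : ℝ≥0∞) : ℝ≥0∞ :=
  ∑' k : ℕ, ENNReal.ofReal (2⁻¹ ^ k) * ENNReal.ofReal ((2⁻¹ ^ (k+1)) ^ (-p.toReal⁻¹))

lemma hardyC_lt {p : ℝ≥0∞} (hp1 : 1 < p) (hp : p ≠ ∞) : hardyC p < ∞ := by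
  have hp1' : 1 < p.toReal := by
    have := (ENNReal.toReal_lt_toReal (by simp) hp).2 hp1
    simpa using this
  have hθ : p.toReal⁻¹ < 1 := inv_lt_one_of_one_lt₀ hp1'
  set θ := p.toReal⁻¹ with hθd
  have h : ∀ k : ℕ, ENNReal.ofReal (2⁻¹ ^ k) * ENNReal.ofReal ((2⁻¹ ^ (k+1)) ^ (-θ))
      = ENNReal.ofReal (2 ^ θ) * ENNReal.ofReal (2 ^ (θ - 1)) ^ k := by
    intro k
    rw [← ENNReal.ofReal_pow (by positivity), ← ENNReal.ofReal_mul (by positivity),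
      ← ENNReal.ofReal_mul (by positivity)]
    congr 1
    have h2 : (2⁻¹ : ℝ) = 2 ^ (-1 : ℝ) := by rw [Real.rpow_neg_one]
    simp only [h2, ← Real.rpow_natCast, ← Real.rpow_mul (by norm_num : (0:ℝ) ≤ 2),
      ← Real.rpow_add (by norm_num : (0:ℝ) < 2)]
    congr 1
    push_cast
    ring
  unfold hardyC
  simp only [← hθd, h]
  rw [ENNReal.tsum_mul_left, ENNReal.tsum_geometric]
  refine ENNReal.mul_lt_top (by simp) ?_
  rw [ENNReal.inv_lt_top, tsub_pos_iff_lt, ← ENNReal.ofReal_one]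
  exact (ENNReal.ofReal_lt_ofReal_iff one_pos).2
    (Real.rpow_lt_one_of_one_lt_of_neg (by norm_num) (by linarith))

lemma lz_avgS {φ : ℝ → ℝ≥0∞} (hφ : Measurable φ) (p : ℝ≥0∞) {r : ℝ≥0∞} (hr : 1 ≤ r) :
    lorentzNormOf (avgS φ) p r ≤ hardyC p * lorentzNormOf φ p r := by
  unfold avgS hardyC
  refine (lz_tsum (fun k => by fun_prop) p hr).trans ?_
  rw [← ENNReal.tsum_mul_right]
  refine ENNReal.tsum_le_tsum fun k => ?_
  rw [lz_const (by fun_prop) _ _ hr, mul_assoc]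
  gcongr
  exact lz_dil _ (by positivity) p hr

lemma weak_avgS {φ : ℝ → ℝ≥0∞} (hφ : Antitone φ) (p : ℝ≥0∞) {r : ℝ≥0∞} (hr : 1 ≤ r)
    {t : ℝ} (ht : 0 < t) :
    ENNReal.ofReal (t ^ p.toReal⁻¹) * avgS φ t
      ≤ hardyC p * ((ENNReal.ofReal (2 ^ p.toReal⁻¹) * 2) * lorentzNormOf φ p r) := by
  unfold avgS hardyC
  rw [← ENNReal.tsum_mul_right, ← ENNReal.tsum_mul_left]
  refine ENNReal.tsum_le_tsum fun k => ?_
  have h := lz_weak p hr hφ (t := 2⁻¹ ^ (k+1) * t) (by positivity)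
  rw [mul_left_comm, mul_assoc]
  refine mul_le_mul_right ?_ _
  refine le_trans (le_of_eq ?_) (mul_le_mul_right h _)
  rw [← mul_assoc, ← ENNReal.ofReal_mul (by positivity), Real.mul_rpow (by positivity) ht.le,
    ← mul_assoc, ← Real.rpow_add (by positivity)]
  simp

/-- The maximal operator on `ℝ≥0∞`-valued functions. -/
noncomputable def MM {N : ℕ} (h : Euc N → ℝ≥0∞) (x : Euc N) : ℝ≥0∞ :=
  ⨆ ρ : {ρ : ℝ // 0 < ρ},
    (volume (Metric.ball x ρ.1))⁻¹ * ∫⁻ y in Metric.ball x ρ.1, h y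

/-- Volume of the unit ball. -/
noncomputable def om (N : ℕ) : ℝ := (volume (Metric.ball (0 : Euc N) 1)).toReal

lemma om_pos (N : ℕ) : 0 < om N :=
  ENNReal.toReal_pos (Metric.measure_ball_pos _ _ one_pos).ne' measure_ball_lt_top.ne

lemma vol_ball {N : ℕ} (x : Euc N) {ρ : ℝ} (hρ : 0 < ρ) :
    volume (Metric.ball x ρ) = ENNReal.ofReal (ρ ^ N * om N) := by
  rw [Measure.addHaar_ball_of_pos _ _ hρ, ENNReal.ofReal_mul (by positivity), om,
    ENNReal.ofReal_toReal measure_ball_lt_top.ne]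
  simp

lemma vol_closedBall {N : ℕ} (x : Euc N) {ρ : ℝ} (hρ : 0 < ρ) :
    volume (Metric.closedBall x ρ) = ENNReal.ofReal (ρ ^ N * om N) := by
  rw [Measure.addHaar_closedBall _ _ hρ.le, ENNReal.ofReal_mul (by positivity), om,
    ENNReal.ofReal_toReal measure_ball_lt_top.ne]
  simp

lemma weak11 {N : ℕ} (hN : 1 ≤ N) (h : Euc N → ℝ≥0∞) (hfin : ∫⁻ y, h y ≠ ∞) {l : ℝ≥0∞}
    (hl : l ≠ 0) (hl' : l ≠ ∞) :
    l * volume {x | l < MM h x} ≤ ENNReal.ofReal (5 ^ N) * ∫⁻ y, h y := by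
  set E := {x | l < MM h x} with hE
  have hex : ∀ x : Euc N, ∃ ρ : ℝ, 0 < ρ ∧ (x ∈ E →
      l * volume (Metric.ball x ρ) ≤ ∫⁻ y in Metric.ball x ρ, h y) := by
    intro x
    by_cases hx : x ∈ E
    · obtain ⟨ρ, hρ⟩ := lt_iSup_iff.1 (show l < MM h x from hx)
      refine ⟨ρ.1, ρ.2, fun _ => ?_⟩
      rw [mul_comm] at hρ
      rw [← div_eq_mul_inv] at hρ
      exact (ENNReal.le_div_iff_mul_le (Or.inl (Metric.measure_ball_pos _ _ ρ.2).ne')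
        (Or.inl measure_ball_lt_top.ne)).1 hρ.le
    · exact ⟨1, one_pos, fun h => absurd h hx⟩
  choose ρ hρ0 hρ using hex
  set B : ℝ := ((∫⁻ y, h y).toReal / (l.toReal * om N)) with hB
  have hl0 : 0 < l.toReal := ENNReal.toReal_pos hl hl'
  have hom := om_pos N
  have hR : ∀ x ∈ E, ρ x ≤ max 1 B := by
    intro x hx
    by_contra! hc
    have h1 : 1 < ρ x := (le_max_left _ _).trans_lt hc
    have h2 : B < ρ x := (le_max_right _ _).trans_lt hc
    have h3 : ρ x ≤ ρ x ^ N := le_self_pow₀ h1.le (by omega)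
    have h4 := (hρ x hx).trans (setLIntegral_le_lintegral _ _)
    rw [vol_ball x (hρ0 x)] at h4
    have h5 := ENNReal.toReal_mono hfin h4
    rw [ENNReal.toReal_mul, ENNReal.toReal_ofReal (by have := hρ0 x; positivity)] at h5
    have h6 : ρ x ^ N ≤ B := by
      rw [hB, le_div_iff₀ (by positivity)]
      linarith
    linarith
  obtain ⟨u, huE, hdisj, hcov⟩ := Vitali.exists_disjoint_subfamily_covering_enlargement_closedBall
    E (fun x => x) ρ (max 1 B) hR 5 (by norm_num)
  have hdisj' : u.PairwiseDisjoint fun a => Metric.ball a (ρ a) :=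
    hdisj.mono fun a => Metric.ball_subset_closedBall
  have hu : u.Countable := hdisj'.countable_of_isOpen (fun _ _ => Metric.isOpen_ball)
    (fun a _ => Metric.nonempty_ball.2 (hρ0 a))
  have hsub : E ⊆ ⋃ b ∈ u, Metric.closedBall b (5 * ρ b) := by
    intro x hx
    obtain ⟨b, hb, hxb⟩ := hcov x hx
    exact mem_iUnion₂.2 ⟨b, hb, hxb (Metric.mem_closedBall_self (hρ0 x).le)⟩
  calc l * volume E ≤ l * ∑' b : u, volume (Metric.closedBall b.1 (5 * ρ b)) := by
        gcongr
        exact (measure_mono hsub).trans (measure_biUnion_le _ hu _)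
    _ = ENNReal.ofReal (5 ^ N) * ∑' b : u, l * volume (Metric.ball b.1 (ρ b)) := by
        rw [← ENNReal.tsum_mul_left, ← ENNReal.tsum_mul_left]
        congr 1; funext b
        have := hρ0 b.1
        rw [vol_closedBall _ (by positivity), vol_ball _ this, mul_pow, mul_assoc,
          ENNReal.ofReal_mul (by positivity)]
        ring
    _ ≤ ENNReal.ofReal (5 ^ N) * ∑' b : u, ∫⁻ y in Metric.ball b.1 (ρ b), h y := by
        gcongr with b
        exact hρ b.1 (huE b.2)
    _ = ENNReal.ofReal (5 ^ N) * ∫⁻ y in ⋃ b ∈ u, Metric.ball b (ρ b), h y := by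
        rw [lintegral_biUnion hu (fun _ _ => measurableSet_ball) hdisj']
    _ ≤ _ := by
        gcongr
        exact Measure.restrict_le_self

/-- Rearrangement of the maximal function. -/
lemma rearr_MM {N : ℕ} (hN : 1 ≤ N) {g : Euc N → ℝ≥0∞} (hg : Measurable g) {t : ℝ} (ht : 0 < t) :
    rearrE volume (MM g) t
      ≤ (ENNReal.ofReal (5 ^ N) + 1) * avgS (rearrE volume g) t := by
  set S := avgS (rearrE volume g) t with hS
  set c := rearrE volume g t with hc
  have hcS : c ≤ S := le_avgS (rearrE_anti volume g) ht
  by_cases hSt : S = ∞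
  · rw [hSt, ENNReal.mul_top (by simp)]
    exact le_top
  set A := {x | c < g x} with hA
  have hAm : MeasurableSet A := measurableSet_lt measurable_const hg
  set h := A.indicator g with hh
  have hIntg : ∫⁻ y, h y ≤ ENNReal.ofReal t * S := by
    rw [hh, lintegral_indicator hAm]
    exact int_le_avgS volume hg ht
  have hfin : ∫⁻ y, h y ≠ ∞ := ne_top_of_le_ne_top (by finiteness) hIntg
  have hgle : ∀ y, g y ≤ h y + c := by
    intro y
    by_cases hy : y ∈ A
    · rw [hh, indicator_of_mem hy]; exact le_self_add
    · rw [hh, indicator_of_notMem hy, zero_add]; exact not_lt.1 hy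
  have hM : ∀ x, MM g x ≤ MM h x + c := by
    intro x
    refine iSup_le fun ρ => ?_
    have hb0 := (Metric.measure_ball_pos (volume : Measure (Euc N)) x ρ.2).ne'
    have hbt := (measure_ball_lt_top (μ := (volume : Measure (Euc N))) (x := x) (r := ρ.1)).ne
    calc _ ≤ (volume (Metric.ball x ρ.1))⁻¹ * ∫⁻ y in Metric.ball x ρ.1, (h y + c) := by
          gcongr with y
          exact hgle y
      _ = (volume (Metric.ball x ρ.1))⁻¹ * (∫⁻ y in Metric.ball x ρ.1, h y) + c := by
          rw [lintegral_add_right _ measurable_const, setLIntegral_const, mul_add,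
            mul_left_comm, ENNReal.inv_mul_cancel hb0 hbt, mul_one]
      _ ≤ _ := by
          gcongr
          exact le_iSup (fun ρ : {ρ : ℝ // 0 < ρ} => (volume (Metric.ball x ρ.1))⁻¹ *
            ∫⁻ y in Metric.ball x ρ.1, h y) ρ
  have hkey : volume {x | ENNReal.ofReal (5 ^ N) * S < MM h x} ≤ ENNReal.ofReal t := by
    by_cases hS0 : S = 0
    · have h0 : ∫⁻ y, h y = 0 := by simpa [hS0] using hIntg
      have : ∀ x, MM h x = 0 := by
        intro x
        refine le_antisymm (iSup_le fun ρ => ?_) zero_le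
        have : ∫⁻ y in Metric.ball x ρ.1, h y = 0 :=
          le_antisymm ((setLIntegral_le_lintegral _ _).trans h0.le) zero_le
        simp [this]
      simp [this]
    · have h5 : ENNReal.ofReal (5 ^ N) ≠ 0 := by simp
      have hw := weak11 hN h hfin (l := ENNReal.ofReal (5 ^ N) * S) (mul_ne_zero h5 hS0)
        (by finiteness)
      have hw2 := hw.trans (mul_le_mul_right hIntg _)
      rw [mul_assoc, ENNReal.mul_le_mul_iff_right h5 (by simp), mul_comm (ENNReal.ofReal t),
        ENNReal.mul_le_mul_iff_right hS0 hSt] at hw2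
      exact hw2
  refine rearrE_le _ (le_trans (measure_mono ?_) hkey)
  intro x hx
  have hx : (ENNReal.ofReal (5 ^ N) + 1) * S < MM g x := hx
  show ENNReal.ofReal (5 ^ N) * S < MM h x
  by_contra! hcon
  have := hx.trans_le (hM x)
  rw [add_mul, one_mul] at this
  exact absurd (add_le_add hcon hcS) (not_le.2 this)

/-- The annuli, extended by the empty set. -/
def Av (N : ℕ) (v : ℤ) : Set (Euc N) := {x | -1 ≤ v ∧ x ∈ annulus (Set.univ : Set (Euc N)) v}

lemma Av_eq {N : ℕ} {v : ℤ} (hv : -1 ≤ v) : Av N v = annulus (Set.univ : Set (Euc N)) v := by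
  ext x; simp [Av, hv]

lemma Av_empty {N : ℕ} {v : ℤ} (hv : ¬ -1 ≤ v) : Av N v = ∅ := by
  ext x; simp [Av, hv]

lemma Av_meas (N : ℕ) (v : ℤ) : MeasurableSet (Av N v) := by
  by_cases hv : -1 ≤ v
  · rw [Av_eq hv]
    unfold annulus
    split_ifs
    · simp only [mem_univ, true_and]
      exact measurableSet_lt measurable_norm measurable_const
    · simp only [mem_univ, true_and]
      exact (measurableSet_le measurable_const measurable_norm).inter
        (measurableSet_lt measurable_norm measurable_const)
  · rw [Av_empty hv]; exact MeasurableSet.empty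

lemma Av_lt {N : ℕ} {v : ℤ} {x : Euc N} (hx : x ∈ Av N v) : ‖x‖ < (2:ℝ) ^ v := by
  obtain ⟨_, h⟩ := hx
  unfold annulus at h
  split_ifs at h with h1
  · rw [h1]
    have h2 : ‖x‖ < 1 / 2 := h.2
    norm_num at h2 ⊢
    exact h2
  · exact h.2.2

lemma Av_ge {N : ℕ} {v : ℤ} {x : Euc N} (hx : x ∈ Av N v) (hv : v ≠ -1) :
    (2:ℝ) ^ (v - 1) ≤ ‖x‖ := by
  obtain ⟨_, h⟩ := hx
  unfold annulus at h
  rw [if_neg hv] at h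
  exact h.2.1

lemma Av_cover {N : ℕ} (x : Euc N) : ∃ v, x ∈ Av N v := by
  by_cases hx : ‖x‖ < 1 / 2
  · refine ⟨-1, le_rfl, ?_⟩
    unfold annulus
    rw [if_pos rfl]
    exact ⟨mem_univ _, hx⟩
  · have hx0 : 0 < ‖x‖ := by linarith
    obtain ⟨n, hn1, hn2⟩ := exists_mem_Ico_zpow hx0 (by norm_num : (1:ℝ) < 2)
    have hn : -1 < n + 1 := by
      rw [← zpow_lt_zpow_iff_right₀ (by norm_num : (1:ℝ) < 2)]
      refine lt_of_le_of_lt ?_ hn2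
      norm_num
      linarith
    refine ⟨n + 1, by omega, ?_⟩
    unfold annulus
    rw [if_neg (by omega)]
    exact ⟨mem_univ _, by simpa using hn1, hn2⟩

/-- Measure of the ball of radius `2^v`. -/
noncomputable def TT (N : ℕ) (v : ℤ) : ℝ := ((2:ℝ) ^ v) ^ N * om N

lemma TT_pos (N : ℕ) (v : ℤ) : 0 < TT N v := by
  have := om_pos N
  unfold TT
  positivity

lemma Av_vol (N : ℕ) (v : ℤ) : volume (Av N v) ≤ ENNReal.ofReal (TT N v) := by
  rw [TT, ← vol_ball (0 : Euc N) (by positivity)]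
  refine measure_mono fun x hx => ?_
  simpa using Av_lt hx

/-- Block of `g`. -/
noncomputable def GG {N : ℕ} (g : Euc N → ℝ≥0∞) (v : ℤ) : Euc N → ℝ≥0∞ := (Av N v).indicator g

lemma GG_meas {N : ℕ} {g : Euc N → ℝ≥0∞} (hg : Measurable g) (v : ℤ) : Measurable (GG g v) :=
  hg.indicator (Av_meas N v)

lemma le_sum_GG {N : ℕ} (g : Euc N → ℝ≥0∞) (x : Euc N) : g x ≤ ∑' v, GG g v x := by
  obtain ⟨v, hv⟩ := Av_cover x
  refine le_trans ?_ (ENNReal.le_tsum v)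
  rw [GG, indicator_of_mem hv]

lemma MM_le {N : ℕ} {g : Euc N → ℝ≥0∞} (hg : Measurable g) (x : Euc N) :
    MM g x ≤ ∑' v, MM (GG g v) x := by
  refine iSup_le fun ρ => ?_
  calc _ ≤ (volume (Metric.ball x ρ.1))⁻¹ * ∫⁻ y in Metric.ball x ρ.1, ∑' v, GG g v y := by
        gcongr with y
        exact le_sum_GG g y
    _ = ∑' v, (volume (Metric.ball x ρ.1))⁻¹ * ∫⁻ y in Metric.ball x ρ.1, GG g v y := by
        rw [lintegral_tsum fun v => (GG_meas hg v).aemeasurable, ENNReal.tsum_mul_left]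
    _ ≤ _ := by
        refine ENNReal.tsum_le_tsum fun v => ?_
        exact le_iSup (fun ρ : {ρ : ℝ // 0 < ρ} => (volume (Metric.ball x ρ.1))⁻¹ *
            ∫⁻ y in Metric.ball x ρ.1, GG g v y) ρ

lemma far_dist {N : ℕ} {u v : ℤ} {x y : Euc N} (hx : x ∈ Av N u) (hy : y ∈ Av N v)
    (huv : v + 2 ≤ u) : (2:ℝ) ^ (u - 2) ≤ ‖x - y‖ := by
  have h1 := Av_ge hx (by have := hy.1; omega)
  have h2 := Av_lt hy
  have h3 : (2:ℝ) ^ v ≤ 2 ^ (u - 2) := zpow_le_zpow_right₀ (by norm_num) (by omega)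
  have h4 : (2:ℝ) ^ (u - 1) = 2 * 2 ^ (u - 2) := by
    rw [show u - 1 = 1 + (u - 2) by ring, zpow_add₀ (by norm_num)]; simp
  have h5 := norm_sub_norm_le x y
  linarith

lemma far_MM {N : ℕ} (g : Euc N → ℝ≥0∞) {u v : ℤ} {x : Euc N} (hx : x ∈ Av N u)
    (huv : ¬ |u - v| ≤ 1) :
    MM (GG g v) x ≤ (ENNReal.ofReal (TT N (max u v - 2)))⁻¹ * ∫⁻ y, GG g v y := by
  refine iSup_le fun ρ => ?_
  by_cases hρ : ρ.1 ≤ (2:ℝ) ^ (max u v - 2)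
  · have h0 : ∫⁻ y in Metric.ball x ρ.1, GG g v y = 0 := by
      rw [setLIntegral_congr_fun (g := fun _ => 0) measurableSet_ball, lintegral_zero]
      intro y hy
      refine indicator_of_notMem (fun hyv => ?_) _
      have hd : ‖x - y‖ < ρ.1 := by
        rw [← dist_eq_norm, dist_comm]; exact hy
      rw [abs_le] at huv
      rcases le_total u v with h | h
      · rw [max_eq_right h] at hρ
        have := far_dist hyv hx (by omega)
        rw [norm_sub_rev] at this
        linarith
      · rw [max_eq_left h] at hρ
        have := far_dist hx hyv (by omega)
        linarith
    rw [h0, mul_zero]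
    exact zero_le
  · push Not at hρ
    gcongr
    · rw [TT, ← vol_ball x (by positivity)]
      exact measure_mono (Metric.ball_subset_ball hρ.le)
    · exact Measure.restrict_le_self

/-- The majorant of block `v` on annulus `u`. -/
noncomputable def FF {N : ℕ} (g : Euc N → ℝ≥0∞) (u v : ℤ) : ℝ → ℝ≥0∞ :=
  if |u - v| ≤ 1 then fun t => (ENNReal.ofReal (5 ^ N) + 1) * avgS (rearrE volume (GG g v)) t
  else fun t => ((ENNReal.ofReal (TT N (max u v - 2)))⁻¹ * ∫⁻ y, GG g v y) * stepF (TT N u) t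

lemma FF_meas {N : ℕ} (g : Euc N → ℝ≥0∞) (u v : ℤ) : Measurable (FF g u v) := by
  unfold FF
  split_ifs
  · exact (avgS_meas (rearrE_anti _ _).measurable).const_mul _
  · exact (stepF_meas _).const_mul _

lemma rearr_block {N : ℕ} (hN : 1 ≤ N) {g : Euc N → ℝ≥0∞} (hg : Measurable g) (u : ℤ)
    {t : ℝ} (ht : 0 < t) :
    rearrE volume ((Av N u).indicator (MM g)) (3 * t) ≤ ∑' v, FF g u v t := by
  apply rearrE_le
  by_cases hT : TT N u ≤ 3 * t
  · refine le_trans (measure_mono (t := Av N u) fun x hx => ?_) ((Av_vol N u).trans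
      (ENNReal.ofReal_le_ofReal hT))
    by_contra h
    have hx : _ < (Av N u).indicator (MM g) x := hx
    rw [indicator_of_notMem h] at hx
    exact _root_.not_lt_zero hx
  · push Not at hT
    have hsub : {x | ∑' v, FF g u v t < (Av N u).indicator (MM g) x} ⊆
        ⋃ v ∈ Finset.Icc (u - 1) (u + 1),
          {x | rearrE volume (MM (GG g v)) t < MM (GG g v) x} := by
      intro x hx
      have hx : ∑' v, FF g u v t < (Av N u).indicator (MM g) x := hx
      by_contra hcon
      simp only [mem_iUnion, not_exists] at hcon
      by_cases hxu : x ∈ Av N u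
      · rw [indicator_of_mem hxu] at hx
        refine absurd (hx.trans_le (MM_le hg x)) (not_lt.2 ?_)
        refine ENNReal.tsum_le_tsum fun v => ?_
        unfold FF
        split_ifs with huv
        · have hle : MM (GG g v) x ≤ rearrE volume (MM (GG g v)) t := not_lt.1 fun hlt => (hcon v (by
            rw [abs_le] at huv
            rw [Finset.mem_Icc]; omega)) hlt
          exact hle.trans (rearr_MM hN (GG_meas hg v) ht)
        · have : stepF (TT N u) t = 1 := if_pos (by linarith)
          simp only [this, mul_one]
          exact far_MM g hxu huv
      · rw [indicator_of_notMem hxu] at hx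
        exact _root_.not_lt_zero hx
    refine (measure_mono hsub).trans ((measure_biUnion_finset_le _ _).trans ?_)
    refine (Finset.sum_le_sum fun v _ => rearrE_meas volume _ t).trans ?_
    rw [Finset.sum_const, Int.card_Icc, ENNReal.ofReal_mul (by norm_num)]
    rw [show (u + 1 + 1 - (u - 1)).toNat = 3 by omega]
    simp

lemma int_block {N : ℕ} {g : Euc N → ℝ≥0∞} (hg : Measurable g) (v : ℤ) :
    ∫⁻ y, GG g v y ≤ ENNReal.ofReal (TT N v) * avgS (rearrE volume (GG g v)) (TT N v) := by
  refine le_trans (le_of_eq ?_) (int_le_avgS volume (GG_meas hg v) (TT_pos N v))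
  have h0 : rearrE volume (GG g v) (TT N v) = 0 := by
    refine le_antisymm (rearrE_le _ ((measure_mono fun x hx => ?_).trans (Av_vol N v))) zero_le
    by_contra h
    have hx : 0 < GG g v x := hx
    rw [GG, indicator_of_notMem h] at hx
    exact _root_.not_lt_zero hx
  rw [h0, ← lintegral_indicator (measurableSet_lt measurable_const (GG_meas hg v))]
  congr 1; funext x
  by_cases hx : 0 < GG g v x
  · rw [indicator_of_mem (by exact hx)]
  · rw [indicator_of_notMem (by exact hx)]
    simpa using hx

/-- Decay exponent. -/
noncomputable def ex (N : ℕ) (a θ : ℝ) (k : ℤ) : ℝ := k * a + N * (k * θ - max (k:ℝ) 0)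

lemma near_real {N : ℕ} {a θ : ℝ} (hθ0 : 0 ≤ θ) (hθ1 : θ ≤ 1) {u v : ℤ} (huv : |u - v| ≤ 1) :
    (2:ℝ) ^ ((u:ℝ) * a) ≤ 2 ^ (2 * N : ℝ) * 2 ^ (ex N a θ (u - v)) * 2 ^ ((v:ℝ) * a) := by
  rw [← Real.rpow_add two_pos, ← Real.rpow_add two_pos]
  refine Real.rpow_le_rpow_of_exponent_le (by norm_num) ?_
  have hk : |((u - v : ℤ) : ℝ)| ≤ 1 := by exact_mod_cast huv
  unfold ex
  set k : ℝ := ((u - v : ℤ) : ℝ) with hkd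
  have hu : (u:ℝ) = k + v := by rw [hkd]; push_cast; ring
  rw [hu]
  have hk' := abs_le.1 hk
  have h1 : max k 0 ≤ 1 := max_le hk'.2 (by norm_num)
  have h2 : -1 ≤ k * θ := by nlinarith
  have hN : (0:ℝ) ≤ N := by positivity
  have : 0 ≤ (N:ℝ) * (2 + k * θ - max k 0) := mul_nonneg hN (by linarith)
  nlinarith

lemma far_real {N : ℕ} (a θ : ℝ) (u v : ℤ) :
    2 ^ ((u:ℝ) * a) * ((TT N (max u v - 2))⁻¹ * (TT N v * TT N v ^ (-θ)) * TT N u ^ θ)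
      = 2 ^ (2 * N : ℝ) * 2 ^ (ex N a θ (u - v)) * 2 ^ ((v:ℝ) * a) := by
  obtain ⟨w, hw⟩ : ∃ w : ℝ, om N = 2 ^ w :=
    ⟨Real.logb 2 (om N), (Real.rpow_logb two_pos (by norm_num) (om_pos N)).symm⟩
  have hT : ∀ v : ℤ, TT N v = (2:ℝ) ^ ((v:ℝ) * N + w) := by
    intro v
    rw [TT, hw, Real.rpow_add two_pos, Real.rpow_mul two_pos.le, Real.rpow_natCast,
      Real.rpow_intCast]
  simp only [hT, ← Real.rpow_mul two_pos.le, ← Real.rpow_neg two_pos.le, ← Real.rpow_add two_pos]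
  congr 1
  unfold ex
  have hm : max ((u - v : ℤ) : ℝ) 0 = max (u:ℝ) v - v := by
    rw [← max_sub_sub_right]; push_cast; simp
  rw [hm]
  push_cast
  ring

/-- Constant of the block estimate. -/
noncomputable def blockC (N : ℕ) (p r : ℝ≥0∞) : ℝ≥0∞ :=
  ENNReal.ofReal (2 ^ (2 * N : ℝ)) * ((ENNReal.ofReal (5 ^ N) + 1) * hardyC p +
    hardyC p * (ENNReal.ofReal (2 ^ p.toReal⁻¹) * 2) * lorentzNormOf (stepF 1) p r)

lemma blockC_lt (N : ℕ) {p r : ℝ≥0∞} (hp1 : 1 < p) (hp : p ≠ ∞) (hr : 1 ≤ r) :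
    blockC N p r < ∞ := by
  have h1 := hardyC_lt hp1 hp
  have h2 := lz_step_one hp1 hp hr
  unfold blockC
  finiteness

lemma lz_FF {N : ℕ} {g : Euc N → ℝ≥0∞} (hg : Measurable g) (a : ℝ) {p r : ℝ≥0∞}
    (hp1 : 1 < p) (hp : p ≠ ∞) (hr : 1 ≤ r) (u v : ℤ) :
    ENNReal.ofReal (2 ^ ((u:ℝ) * a)) * lorentzNormOf (FF g u v) p r ≤
      blockC N p r * ENNReal.ofReal (2 ^ (ex N a p.toReal⁻¹ (u - v))) *
        (ENNReal.ofReal (2 ^ ((v:ℝ) * a)) * lorentzNormOf (rearrE volume (GG g v)) p r) := by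
  have hp1' : 1 < p.toReal := by
    have := (ENNReal.toReal_lt_toReal (by simp) hp).2 hp1
    simpa using this
  have hθ0 : 0 ≤ p.toReal⁻¹ := by positivity
  have hθ1 : p.toReal⁻¹ < 1 := inv_lt_one_of_one_lt₀ hp1'
  set θ := p.toReal⁻¹ with hθ
  set L := lorentzNormOf (rearrE volume (GG g v)) p r with hL
  have hTv := TT_pos N v
  have hTu := TT_pos N u
  have hTm := TT_pos N (max u v - 2)
  unfold FF
  split_ifs with huv
  · rw [lz_const (avgS_meas (rearrE_anti _ _).measurable) _ _ hr]
    calc _ ≤ ENNReal.ofReal (2 ^ (2 * N : ℝ) * 2 ^ (ex N a θ (u - v)) * 2 ^ ((v:ℝ) * a)) *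
          ((ENNReal.ofReal (5 ^ N) + 1) * (hardyC p * L)) := by
          refine mul_le_mul' (ENNReal.ofReal_le_ofReal (near_real hθ0 hθ1.le huv))
            (mul_le_mul_right (lz_avgS (rearrE_anti _ _).measurable p hr) _)
      _ = (ENNReal.ofReal (2 ^ (2 * N : ℝ)) * ((ENNReal.ofReal (5 ^ N) + 1) * hardyC p)) *
          ENNReal.ofReal (2 ^ (ex N a θ (u - v))) * (ENNReal.ofReal (2 ^ ((v:ℝ) * a)) * L) := by
          rw [ENNReal.ofReal_mul (by positivity), ENNReal.ofReal_mul (by positivity)]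
          ring
      _ ≤ _ := by
          unfold blockC
          gcongr
          exact le_self_add
  · rw [lz_const (stepF_meas _) _ _ hr]
    set Q := hardyC p * ((ENNReal.ofReal (2 ^ θ) * 2) * L) with hQ
    have hav : avgS (rearrE volume (GG g v)) (TT N v) ≤ ENNReal.ofReal (TT N v ^ (-θ)) * Q := by
      refine le_trans (le_of_eq ?_) (mul_le_mul_right
        (weak_avgS (rearrE_anti volume (GG g v)) p hr (TT_pos N v)) _)
      rw [← mul_assoc, ← ENNReal.ofReal_mul (by positivity), ← Real.rpow_add hTv]
      simp [hθ]
    have hIntg : ∫⁻ y, GG g v y ≤ ENNReal.ofReal (TT N v * TT N v ^ (-θ)) * Q := by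
      rw [ENNReal.ofReal_mul hTv.le, mul_assoc]
      exact (int_block hg v).trans (mul_le_mul_right hav _)
    calc _ ≤ ENNReal.ofReal (2 ^ ((u:ℝ) * a)) * ((ENNReal.ofReal (TT N (max u v - 2)))⁻¹ *
          (ENNReal.ofReal (TT N v * TT N v ^ (-θ)) * Q) * (ENNReal.ofReal (TT N u ^ θ) *
            lorentzNormOf (stepF 1) p r)) := by
          refine mul_le_mul_right (mul_le_mul' (mul_le_mul_right hIntg _) (lz_step p hr hTu)) _
      _ = ENNReal.ofReal (2 ^ ((u:ℝ) * a) * ((TT N (max u v - 2))⁻¹ * (TT N v * TT N v ^ (-θ))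
            * TT N u ^ θ)) * (Q * lorentzNormOf (stepF 1) p r) := by
          rw [← ENNReal.ofReal_inv_of_pos hTm, ENNReal.ofReal_mul (p := 2 ^ ((u:ℝ) * a))
            (by positivity), ENNReal.ofReal_mul (q := TT N u ^ θ) (by positivity),
            ENNReal.ofReal_mul (p := (TT N (max u v - 2))⁻¹) (by positivity)]
          ring
      _ = (ENNReal.ofReal (2 ^ (2 * N : ℝ)) *
            (hardyC p * (ENNReal.ofReal (2 ^ θ) * 2) * lorentzNormOf (stepF 1) p r)) *
          ENNReal.ofReal (2 ^ (ex N a θ (u - v))) * (ENNReal.ofReal (2 ^ ((v:ℝ) * a)) * L) := by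
          rw [far_real, ENNReal.ofReal_mul (by positivity), ENNReal.ofReal_mul (by positivity), hQ]
          ring
      _ ≤ _ := by
          unfold blockC
          rw [← hθ]
          refine mul_le_mul' (mul_le_mul' (mul_le_mul_right ?_ _) le_rfl) le_rfl
          exact le_add_self

lemma block_bound {N : ℕ} (hN : 1 ≤ N) {g : Euc N → ℝ≥0∞} (hg : Measurable g) (a : ℝ)
    {p r : ℝ≥0∞} (hp1 : 1 < p) (hp : p ≠ ∞) (hr : 1 ≤ r) (u : ℤ) :
    ENNReal.ofReal (2 ^ ((u:ℝ) * a)) *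
        lorentzNormOf (rearrE volume ((Av N u).indicator (MM g))) p r ≤
      ∑' k : ℤ, (ENNReal.ofReal (3⁻¹ ^ (-p.toReal⁻¹)) * blockC N p r *
        ENNReal.ofReal (2 ^ (ex N a p.toReal⁻¹ k))) *
        (ENNReal.ofReal (2 ^ (((u - k : ℤ):ℝ) * a)) *
          lorentzNormOf (rearrE volume (GG g (u - k))) p r) := by
  set H := rearrE volume ((Av N u).indicator (MM g)) with hH
  have h1 : lorentzNormOf H p r ≤ ENNReal.ofReal (3⁻¹ ^ (-p.toReal⁻¹)) *
      lorentzNormOf (fun t => H (3 * t)) p r := by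
    refine le_trans (le_of_eq ?_)
      (lz_dil (fun t => H (3 * t)) (by norm_num : (0:ℝ) < 3⁻¹) p hr)
    congr 1; funext t; congr 1; ring
  have h2 : lorentzNormOf (fun t => H (3 * t)) p r ≤ ∑' v, lorentzNormOf (FF g u v) p r :=
    (lz_mono p r fun t ht => rearr_block hN hg u ht).trans (lz_tsum (FF_meas g u) p hr)
  calc _ ≤ ENNReal.ofReal (2 ^ ((u:ℝ) * a)) * (ENNReal.ofReal (3⁻¹ ^ (-p.toReal⁻¹)) *
        ∑' v, lorentzNormOf (FF g u v) p r) := by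
        exact mul_le_mul_right (h1.trans (mul_le_mul_right h2 _)) _
    _ = ∑' v, ENNReal.ofReal (3⁻¹ ^ (-p.toReal⁻¹)) *
        (ENNReal.ofReal (2 ^ ((u:ℝ) * a)) * lorentzNormOf (FF g u v) p r) := by
        rw [mul_left_comm, ENNReal.tsum_mul_left, ENNReal.tsum_mul_left]
    _ = ∑' k, ENNReal.ofReal (3⁻¹ ^ (-p.toReal⁻¹)) *
        (ENNReal.ofReal (2 ^ ((u:ℝ) * a)) * lorentzNormOf (FF g u (u - k)) p r) := by
        exact ((Equiv.subLeft u).tsum_eq (fun v => ENNReal.ofReal (3⁻¹ ^ (-p.toReal⁻¹)) *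
        (ENNReal.ofReal (2 ^ ((u:ℝ) * a)) * lorentzNormOf (FF g u v) p r))).symm
    _ ≤ _ := by
        refine ENNReal.tsum_le_tsum fun k => ?_
        have := lz_FF hg a hp1 hp hr u (u - k)
        rw [show u - (u - k) = k by ring] at this
        refine (mul_le_mul_right this _).trans (le_of_eq ?_)
        ring

lemma sum_ex {N : ℕ} {a θ : ℝ} (h1 : -(N * θ) < a) (h2 : a < N * (1 - θ)) :
    ∑' k : ℤ, ENNReal.ofReal ((2:ℝ) ^ (ex N a θ k)) < ∞ := by
  refine Summable.tsum_ofReal_lt_top ?_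
  refine Summable.of_nat_of_neg ?_ ?_
  · have : ∀ n : ℕ, (2:ℝ) ^ (ex N a θ (n:ℤ)) = ((2:ℝ) ^ (a - N * (1 - θ))) ^ n := by
      intro n
      rw [← Real.rpow_natCast, ← Real.rpow_mul two_pos.le]
      congr 1
      unfold ex
      rw [max_eq_left (by positivity)]
      push_cast
      ring
    simp only [this]
    exact summable_geometric_of_lt_one (by positivity)
      (Real.rpow_lt_one_of_one_lt_of_neg (by norm_num) (by linarith))
  · have : ∀ n : ℕ, (2:ℝ) ^ (ex N a θ (-(n:ℤ))) = ((2:ℝ) ^ (-(a + N * θ))) ^ n := by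
      intro n
      rw [← Real.rpow_natCast, ← Real.rpow_mul two_pos.le]
      congr 1
      unfold ex
      rw [max_eq_right (by push_cast; simp)]
      push_cast
      ring
    simp only [this]
    exact summable_geometric_of_lt_one (by positivity)
      (Real.rpow_lt_one_of_one_lt_of_neg (by norm_num) (by linarith))

lemma lq_conv {q : ℝ} (hq : 1 ≤ q) (c b : ℤ → ℝ≥0∞) :
    (∑' u : ℤ, (∑' k : ℤ, c k * b (u - k)) ^ q) ^ q⁻¹ ≤ (∑' k, c k) * (∑' u, b u ^ q) ^ q⁻¹ := by
  have hq0 : 0 < q := by linarith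
  have h := lp_tsum (Measure.count : Measure ℤ) (fun k u => c k * b (u - k))
    (fun k => measurable_of_countable _) hq
  simp only [lintegral_count] at h
  refine h.trans (le_of_eq ?_)
  rw [← ENNReal.tsum_mul_right]
  congr 1; funext k
  simp only [ENNReal.mul_rpow_of_nonneg _ _ hq0.le]
  rw [ENNReal.tsum_mul_left, ENNReal.mul_rpow_of_nonneg _ _ (by positivity), ← ENNReal.rpow_mul,
    mul_inv_cancel₀ hq0.ne', ENNReal.rpow_one]
  congr 2
  exact (Equiv.subRight k).tsum_eq (fun u => b u ^ q)

lemma herz_bound {q : ℝ≥0∞} (hq : 1 ≤ q) {Y c b : ℤ → ℝ≥0∞} (hb : ∀ v, ¬ -1 ≤ v → b v = 0)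
    (hY : ∀ u, -1 ≤ u → Y u ≤ ∑' k, c k * b (u - k)) :
    (if q = ∞ then ⨆ u : {u : ℤ // -1 ≤ u}, Y u.1
      else (∑' u : {u : ℤ // -1 ≤ u}, (Y u.1) ^ q.toReal) ^ q.toReal⁻¹) ≤
    (∑' k, c k) * (if q = ∞ then ⨆ u : {u : ℤ // -1 ≤ u}, b u.1
      else (∑' u : {u : ℤ // -1 ≤ u}, (b u.1) ^ q.toReal) ^ q.toReal⁻¹) := by
  split_ifs with hq'
  · refine iSup_le fun u => (hY u.1 u.2).trans ?_
    rw [← ENNReal.tsum_mul_right]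
    refine ENNReal.tsum_le_tsum fun k => mul_le_mul_right ?_ _
    by_cases hk : -1 ≤ u.1 - k
    · exact le_iSup (fun u : {u : ℤ // -1 ≤ u} => b u.1) ⟨u.1 - k, hk⟩
    · rw [hb _ hk]; exact zero_le
  · have hq1 : 1 ≤ q.toReal := (ENNReal.toReal_mono hq' hq).trans' (by simp)
    have hq0 : 0 < q.toReal := by linarith
    have hsum : ∑' u : {u : ℤ // -1 ≤ u}, (b u.1) ^ q.toReal = ∑' u : ℤ, b u ^ q.toReal := by
      refine tsum_subtype_eq_of_support_subset (f := fun u => b u ^ q.toReal)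
        (s := {u : ℤ | -1 ≤ u}) fun u hu => ?_
      by_contra h
      refine hu ?_
      simp [hb u h, hq0]
    rw [hsum]
    refine le_trans (ENNReal.rpow_le_rpow ?_ (by positivity)) (lq_conv hq1 c b)
    calc _ ≤ ∑' u : {u : ℤ // -1 ≤ u}, (∑' k, c k * b (u.1 - k)) ^ q.toReal := by
          refine ENNReal.tsum_le_tsum fun u => ENNReal.rpow_le_rpow (hY u.1 u.2) hq0.le
      _ ≤ _ := ENNReal.tsum_comp_le_tsum_of_injective Subtype.val_injective
          (fun u : ℤ => (∑' k, c k * b (u - k)) ^ q.toReal)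

end LorentzHerz

/-- For `1 < p < ∞`, `1 ≤ q, r ≤ ∞` and `−N/p < a < N/p'`, the
Hardy–Littlewood maximal operator is bounded on `HL^{a,r}_{p,q}(ℝ^N)`. -/
theorem maximal_bounded_on_lorentzHerz {N : ℕ} (hN : 1 ≤ N)
    (p q r : ℝ≥0∞) (hp1 : 1 < p) (hp : p ≠ ∞) (hq : 1 ≤ q) (hr : 1 ≤ r)
    (a : ℝ) (ha₁ : -((N : ℝ) / p.toReal) < a) (ha₂ : a < (N : ℝ) / (conjExp p).toReal) :
    ∃ C : ℝ≥0∞, C < ∞ ∧ ∀ f : Euc N → ℝ, Measurable f →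
      herzNorm volume (Set.univ : Set (Euc N)) a p q r f < ∞ →
      herzNormE volume (Set.univ : Set (Euc N)) a p q r (hlMaximal volume f)
        ≤ C * herzNorm volume (Set.univ : Set (Euc N)) a p q r f := by
  classical
  have hp1' : 1 < p.toReal := by
    have := (ENNReal.toReal_lt_toReal (by simp) hp).2 hp1
    simpa using this
  have hconj : (conjExp p).toReal = p.toReal / (p.toReal - 1) := by
    unfold conjExp
    rw [if_neg hp1.ne', if_neg hp, ENNReal.toReal_ofReal]
    exact div_nonneg (by linarith) (by linarith)
  have ha₂' : a < N * (1 - p.toReal⁻¹) := by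
    rw [hconj] at ha₂
    convert ha₂ using 1
    have : p.toReal ≠ 0 := by linarith
    have : p.toReal - 1 ≠ 0 := by linarith
    field_simp
  set c : ℤ → ℝ≥0∞ := fun k => ENNReal.ofReal (3⁻¹ ^ (-p.toReal⁻¹)) *
    LorentzHerz.blockC N p r * ENNReal.ofReal (2 ^ (LorentzHerz.ex N a p.toReal⁻¹ k)) with hc
  refine ⟨∑' k, c k, ?_, ?_⟩
  · rw [hc, ENNReal.tsum_mul_left]
    have h1 := LorentzHerz.blockC_lt N hp1 hp hr
    have h2 := LorentzHerz.sum_ex (N := N) (a := a) (θ := p.toReal⁻¹)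
      (by simpa [div_eq_mul_inv] using ha₁) ha₂'
    exact ENNReal.mul_lt_top (ENNReal.mul_lt_top (by simp) h1) h2
  · intro f hf _
    set g : Euc N → ℝ≥0∞ := fun x => ENNReal.ofReal |f x| with hg
    have hgm : Measurable g := (measurable_norm.comp hf).ennreal_ofReal
    set b : ℤ → ℝ≥0∞ := fun v => ENNReal.ofReal (2 ^ ((v:ℝ) * a)) *
      lorentzNormOf (rearrE volume (LorentzHerz.GG g v)) p r with hb
    set Y : ℤ → ℝ≥0∞ := fun u => ENNReal.ofReal (2 ^ ((u:ℝ) * a)) *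
      lorentzNormOf (rearrE volume ((LorentzHerz.Av N u).indicator (LorentzHerz.MM g))) p r with hY
    have hb0 : ∀ v, ¬ -1 ≤ v → b v = 0 := by
      intro v hv
      have h0 : rearrE volume (LorentzHerz.GG g v) = fun _ => 0 * 0 := by
        funext s
        refine le_antisymm ?_ (by simp)
        refine LorentzHerz.rearrE_le _ ?_
        simp [LorentzHerz.GG, LorentzHerz.Av_empty hv]
      simp only [hb]
      rw [h0, LorentzHerz.lz_const (R := fun _ => 0) measurable_const 0 p hr, zero_mul, mul_zero]
    have key := LorentzHerz.herz_bound hq (Y := Y) (c := c) hb0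
      (fun u _ => LorentzHerz.block_bound hN hgm a hp1 hp hr u)
    have hL : herzNormE volume (Set.univ : Set (Euc N)) a p q r (hlMaximal volume f) =
        (if q = ∞ then ⨆ u : {u : ℤ // -1 ≤ u}, Y u.1
          else (∑' u : {u : ℤ // -1 ≤ u}, (Y u.1) ^ q.toReal) ^ q.toReal⁻¹) := by
      have : ∀ u : {u : ℤ // -1 ≤ u}, Y u.1 = ENNReal.ofReal ((2 : ℝ) ^ ((u.1 : ℝ) * a)) *
          lorentzNormE volume p r ((annulus Set.univ u.1).indicator (hlMaximal volume f)) := by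
        intro u
        rw [← LorentzHerz.Av_eq u.2]
        rfl
      simp only [this]
      rfl
    have hR : herzNorm volume (Set.univ : Set (Euc N)) a p q r f =
        (if q = ∞ then ⨆ u : {u : ℤ // -1 ≤ u}, b u.1
          else (∑' u : {u : ℤ // -1 ≤ u}, (b u.1) ^ q.toReal) ^ q.toReal⁻¹) := by
      have : ∀ u : {u : ℤ // -1 ≤ u}, b u.1 = ENNReal.ofReal ((2 : ℝ) ^ ((u.1 : ℝ) * a)) *
          lorentzNorm volume p r ((annulus Set.univ u.1).indicator f) := by
        intro u
        rw [← LorentzHerz.Av_eq u.2]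
        have h1 : LorentzHerz.GG g u.1
            = fun x => ENNReal.ofReal |(LorentzHerz.Av N u.1).indicator f x| := by
          funext x
          by_cases hx : x ∈ LorentzHerz.Av N u.1
          · simp [LorentzHerz.GG, hx, hg]
          · simp [LorentzHerz.GG, hx]
        simp only [hb, h1]
        rfl
      simp only [this]
      rfl
    rw [hL, hR]
    exact key
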